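/- Let a ≥ 0, b > 0, c > 0 and let f:(0,∞)→(0,∞) be non-increasing with t ↦ t² f(t) non-decreasing. Define F(r) := ∫_0^∞ t^{−a} e^{−b²t} e^{−r²/(c²t)} f(t) dt for r > 0. Then there exist constants 0 < c₁ ≤ c₂ (depending only on a, b, c) such that c₁ r^{−a+1/2} f(r/(bc)) e^{−2br/c} ≤ F(r) ≤ c₂ r^{−a+1/2} f(r/(bc)) e^{−2br/c} for all r ≥ 1. -/

import Mathlib

open MeasureTheory Filter Set Topology


lemma aux_rpow_le (p κ : ℝ) (hp : 0 ≤ p) (hκ : 0 < κ) :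
    ∃ C : ℝ, 0 < C ∧ ∀ u : ℝ, 0 < u → u ^ p ≤ C * Real.exp (κ * u) := by
  obtain ⟨n, hn⟩ := exists_nat_ge p
  refine ⟨1 + n.factorial / κ ^ n, by positivity, fun u hu => ?_⟩
  have h1 : u ^ p ≤ 1 + u ^ n := by
    rcases le_total u 1 with h | h
    · have := Real.rpow_le_one hu.le h hp
      have : 0 < u ^ n := by positivity
      linarith
    · have := Real.rpow_le_rpow_of_exponent_le h hn
      rw [Real.rpow_natCast] at this
      linarith
  have h2 : 1 ≤ Real.exp (κ * u) := Real.one_le_exp (by positivity)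
  have h3 := Real.pow_div_factorial_le_exp (κ * u) (by positivity) n
  have h4 : u ^ n ≤ n.factorial / κ ^ n * Real.exp (κ * u) := by
    have h5 : u ^ n = n.factorial / κ ^ n * ((κ * u) ^ n / n.factorial) := by
      rw [mul_pow]
      have : (n.factorial : ℝ) ≠ 0 := by positivity
      field_simp
    rw [h5]
    gcongr
  linarith

lemma aux_bdd (a κ : ℝ) (ha : 0 ≤ a) (hκ : 0 < κ) :
    ∃ M : ℝ, 0 < M ∧ ∀ s : ℝ, 0 < s →
      s ^ (-a) * (1 + 1 / s ^ 2) * Real.exp (-(κ * ((s - 1) ^ 2 / s))) ≤ M := by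
  obtain ⟨C, hC, h⟩ := aux_rpow_le a κ ha hκ
  obtain ⟨D, hD, h'⟩ := aux_rpow_le (a + 2) κ (by linarith) hκ
  refine ⟨(C + D) * Real.exp (2 * κ), by positivity, fun s hs => ?_⟩
  have hu : 0 < s⁻¹ := by positivity
  have e1 : s ^ (-a) * (1 + 1 / s ^ 2) = s⁻¹ ^ a + s⁻¹ ^ (a + 2) := by
    rw [Real.rpow_add hu, Real.inv_rpow hs.le, Real.rpow_neg hs.le]
    norm_num
    ring
  have e2 : Real.exp (-(κ * ((s - 1) ^ 2 / s))) ≤ Real.exp (2 * κ) * Real.exp (-(κ * s⁻¹)) := by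
    rw [← Real.exp_add]
    apply Real.exp_le_exp.2
    have : (s - 1) ^ 2 / s = s - 2 + s⁻¹ := by field_simp; ring
    rw [this]
    nlinarith [mul_pos hκ hs]
  have e3 : Real.exp (κ * s⁻¹) * Real.exp (-(κ * s⁻¹)) = 1 := by
    rw [← Real.exp_add]; simp
  calc _ ≤ ((C + D) * Real.exp (κ * s⁻¹)) * (Real.exp (2 * κ) * Real.exp (-(κ * s⁻¹))) := by
        rw [e1]
        apply mul_le_mul _ e2 (by positivity) (by positivity)
        linarith [h _ hu, h' _ hu]
    _ = (C + D) * Real.exp (2 * κ) * (Real.exp (κ * s⁻¹) * Real.exp (-(κ * s⁻¹))) := by ring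
    _ = _ := by rw [e3, mul_one]

lemma aux_exp (l s : ℝ) (hl : 0 < l) (hs : 0 < s) :
    Real.exp (-(l / 2 * ((s - 1) ^ 2 / s))) ≤
      Real.exp (-(l / 6) * (s - 1) ^ 2) + Real.exp (-(2 * l / 9) * s) := by
  rcases le_total s 3 with h | h
  · have : Real.exp (-(l / 2 * ((s - 1) ^ 2 / s))) ≤ Real.exp (-(l / 6) * (s - 1) ^ 2) := by
      apply Real.exp_le_exp.2
      have h1 : (s - 1) ^ 2 / 3 ≤ (s - 1) ^ 2 / s := by gcongr
      nlinarith
    linarith [Real.exp_pos (-(2 * l / 9) * s)]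
  · have : Real.exp (-(l / 2 * ((s - 1) ^ 2 / s))) ≤ Real.exp (-(2 * l / 9) * s) := by
      apply Real.exp_le_exp.2
      have h1 : 4 / 9 * s ≤ (s - 1) ^ 2 / s := by
        rw [le_div_iff₀ hs]; nlinarith
      nlinarith
    linarith [Real.exp_pos (-(l / 6) * (s - 1) ^ 2)]

lemma aux_key (a l0 : ℝ) (ha : 0 ≤ a) (hl0 : 0 < l0) :
    ∃ c₁ c₂ : ℝ, 0 < c₁ ∧ c₁ ≤ c₂ ∧ ∀ h : ℝ → ℝ, ∀ l : ℝ, l0 ≤ l →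
      (∀ t : ℝ, 0 < t → 0 < h t) →
      (∀ s t : ℝ, 0 < s → s ≤ t → h t ≤ h s) →
      (∀ s t : ℝ, 0 < s → s ≤ t → s ^ 2 * h s ≤ t ^ 2 * h t) →
      c₁ * (h 1 / √l) ≤
        (∫ s in Set.Ioi (0:ℝ), s ^ (-a) * Real.exp (-(l * ((s - 1) ^ 2 / s))) * h s) ∧
      (∫ s in Set.Ioi (0:ℝ), s ^ (-a) * Real.exp (-(l * ((s - 1) ^ 2 / s))) * h s) ≤
        c₂ * (h 1 / √l) := by
  obtain ⟨M, hM, hMb⟩ := aux_bdd a (l0 / 2) ha (by positivity)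
  set L : ℝ := 1 + 1 / √l0 with hL
  have hL1 : 1 < L := by
    have : 0 < 1 / √l0 := by positivity
    linarith
  have hL0 : 0 < L := by linarith
  refine ⟨L ^ (-a) * Real.exp (-1) * (1 / L ^ 2),
    max (L ^ (-a) * Real.exp (-1) * (1 / L ^ 2)) (M * (√(6 * Real.pi) + 9 / (2 * √l0))),
    by positivity, le_max_left _ _, fun h l hl hpos hanti hmono => ?_⟩
  have hlp : 0 < l := hl0.trans_le hl
  have h1 := hpos 1 one_pos
  set G : ℝ → ℝ := fun s => s ^ (-a) * Real.exp (-(l * ((s - 1) ^ 2 / s))) * h s with hG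
  set B : ℝ → ℝ := fun s =>
    M * h 1 * (Real.exp (-(l / 6) * (s - 1) ^ 2) + Real.exp (-(2 * l / 9) * s)) with hB
  have hGpos : ∀ s, 0 < s → 0 < G s := fun s hs => by
    have := hpos s hs
    simp only [hG]
    positivity
  have hGB : ∀ s, 0 < s → G s ≤ B s := fun s hs => by
    have hh : h s ≤ (1 + 1 / s ^ 2) * h 1 := by
      rcases le_total s 1 with hs1 | hs1
      · have := hmono s 1 hs hs1
        have h2 : h s ≤ 1 / s ^ 2 * h 1 := by
          rw [one_div_mul_eq_div, le_div_iff₀ (by positivity)]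
          linarith
        linarith
      · have := hanti 1 s one_pos hs1
        have : 0 < 1 / s ^ 2 * h 1 := by positivity
        linarith
    have hφ : 0 ≤ (s - 1) ^ 2 / s := by positivity
    have he : Real.exp (-(l * ((s - 1) ^ 2 / s))) ≤
        Real.exp (-(l0 / 2 * ((s - 1) ^ 2 / s))) * Real.exp (-(l / 2 * ((s - 1) ^ 2 / s))) := by
      rw [← Real.exp_add]
      apply Real.exp_le_exp.2
      nlinarith
    calc G s ≤ s ^ (-a) * (Real.exp (-(l0 / 2 * ((s - 1) ^ 2 / s))) *
          Real.exp (-(l / 2 * ((s - 1) ^ 2 / s)))) * ((1 + 1 / s ^ 2) * h 1) := by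
          simp only [hG]
          have := (hpos s hs).le
          gcongr
      _ = (s ^ (-a) * (1 + 1 / s ^ 2) * Real.exp (-(l0 / 2 * ((s - 1) ^ 2 / s)))) * h 1 *
          Real.exp (-(l / 2 * ((s - 1) ^ 2 / s))) := by ring
      _ ≤ M * h 1 * (Real.exp (-(l / 6) * (s - 1) ^ 2) + Real.exp (-(2 * l / 9) * s)) := by
          gcongr
          · exact hMb s hs
          · exact aux_exp l s hlp hs
  have hi1 : Integrable (fun s : ℝ => Real.exp (-(l / 6) * (s - 1) ^ 2)) :=
    (integrable_exp_neg_mul_sq (b := l / 6) (by positivity)).comp_sub_right 1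
  have hi2 : IntegrableOn (fun s : ℝ => Real.exp (-(2 * l / 9) * s)) (Ioi 0) :=
    exp_neg_integrableOn_Ioi 0 (by positivity)
  have hBi : IntegrableOn B (Ioi 0) := (hi1.integrableOn.add hi2).const_mul _
  have hhm : AEMeasurable h (volume.restrict (Ioi 0)) :=
    aemeasurable_restrict_of_antitoneOn measurableSet_Ioi
      (fun s hs t _ hst => hanti s t hs hst)
  have hGi : IntegrableOn G (Ioi 0) := by
    refine Integrable.mono' hBi ?_ ?_
    · apply AEMeasurable.aestronglyMeasurable
      apply AEMeasurable.mul _ hhm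
      apply Measurable.aemeasurable
      fun_prop
    · filter_upwards [ae_restrict_mem measurableSet_Ioi] with s hs
      rw [Real.norm_of_nonneg (hGpos s hs).le]
      exact hGB s hs
  constructor
  · have hsub : Icc 1 (1 + 1 / √l) ⊆ Ioi (0:ℝ) := fun s hs => lt_of_lt_of_le one_pos hs.1
    have hle : ∫ s in Icc 1 (1 + 1 / √l), G s ≤ ∫ s in Ioi 0, G s :=
      setIntegral_mono_set hGi
        (by filter_upwards [ae_restrict_mem measurableSet_Ioi] with s hs using (hGpos s hs).le)
        hsub.eventuallyLE
    refine le_trans ?_ hle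
    have hconst : ∫ s in Icc 1 (1 + 1 / √l), (L ^ (-a) * Real.exp (-1) * (1 / L ^ 2 * h 1)) =
        L ^ (-a) * Real.exp (-1) * (1 / L ^ 2) * (h 1 / √l) := by
      rw [setIntegral_const, measureReal_def, Real.volume_Icc, ENNReal.toReal_ofReal]
      · simp only [smul_eq_mul]; ring
      · have : 0 < 1 / √l := by positivity
        linarith
    rw [← hconst]
    apply setIntegral_mono_on _ (hGi.mono_set hsub) measurableSet_Icc
    · intro s hs
      have hs0 : 0 < s := hsub hs
      have hsL : s ≤ L := hs.2.trans (by rw [hL]; gcongr)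
      have g1 : L ^ (-a) ≤ s ^ (-a) := Real.rpow_le_rpow_of_nonpos hs0 hsL (by linarith)
      have g2 : Real.exp (-1) ≤ Real.exp (-(l * ((s - 1) ^ 2 / s))) := by
        apply Real.exp_le_exp.2
        have k1 : (s - 1) ^ 2 / s ≤ (s - 1) ^ 2 := div_le_self (by positivity) hs.1
        have k2 : (s - 1) ^ 2 ≤ (1 / √l) ^ 2 := by
          have := hs.1
          have := hs.2
          exact pow_le_pow_left₀ (by linarith) (by linarith) 2
        have k3 : (1 / √l) ^ 2 = 1 / l := by rw [div_pow, Real.sq_sqrt hlp.le, one_pow]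
        have k4 : l * ((s - 1) ^ 2 / s) ≤ l * (1 / l) :=
          mul_le_mul_of_nonneg_left (by linarith) hlp.le
        have k5 : l * (1 / l) = 1 := by field_simp
        linarith
      have g3 : 1 / L ^ 2 * h 1 ≤ h s := by
        rw [one_div_mul_eq_div, div_le_iff₀ (by positivity)]
        have k1 := hmono 1 s one_pos hs.1
        have k2 : s ^ 2 * h s ≤ L ^ 2 * h s := by
          have := (hpos s hs0).le
          gcongr
        linarith
      simp only [hG]
      gcongr
    · exact integrableOn_const (by simp)
  · have hle : ∫ s in Ioi 0, G s ≤ ∫ s in Ioi 0, B s :=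
      setIntegral_mono_on hGi hBi measurableSet_Ioi (fun s hs => hGB s hs)
    refine hle.trans ?_
    have hBv : ∫ s in Ioi 0, B s = M * h 1 * ((∫ s in Ioi 0, Real.exp (-(l / 6) * (s - 1) ^ 2)) +
        ∫ s in Ioi 0, Real.exp (-(2 * l / 9) * s)) := by
      simp only [hB]
      rw [integral_const_mul, integral_add hi1.integrableOn hi2]
    have v1 : (∫ s in Ioi 0, Real.exp (-(l / 6) * (s - 1) ^ 2)) ≤ √(6 * Real.pi) / √l := by
      have w1 : (∫ s in Ioi 0, Real.exp (-(l / 6) * (s - 1) ^ 2)) ≤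
          ∫ s, Real.exp (-(l / 6) * (s - 1) ^ 2) :=
        setIntegral_le_integral hi1 (Eventually.of_forall fun s => (Real.exp_pos _).le)
      rw [integral_sub_right_eq_self (μ := volume) (fun s : ℝ => Real.exp (-(l / 6) * s ^ 2)) 1,
        integral_gaussian] at w1
      rw [← Real.sqrt_div (by positivity)]
      convert w1 using 2
      field_simp
    have v2 : (∫ s in Ioi 0, Real.exp (-(2 * l / 9) * s)) ≤ 9 / (2 * √l0) / √l := by
      rw [integral_exp_mul_Ioi (by linarith)]
      have w : √l0 * √l ≤ l := by
        calc √l0 * √l ≤ √l * √l := by gcongr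
          _ = l := Real.mul_self_sqrt hlp.le
      have : -Real.exp (-(2 * l / 9) * 0) / (-(2 * l / 9)) = 9 / 2 / l := by
        simp
        field_simp
      rw [this]
      calc 9 / 2 / l ≤ 9 / 2 / (√l0 * √l) := by gcongr
        _ = _ := by field_simp
    rw [hBv]
    calc _ ≤ M * h 1 * (√(6 * Real.pi) / √l + 9 / (2 * √l0) / √l) := by gcongr
      _ = (M * (√(6 * Real.pi) + 9 / (2 * √l0))) * (h 1 / √l) := by ring
      _ ≤ _ := by
        gcongr
        exact le_max_right _ _

/-- Lemma A.1: for `a ≥ 0`, `b, c > 0` there are constants `0 < c₁ ≤ c₂` (depending only on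
`a`, `b`, `c`) such that for every non-increasing `f : (0,∞) → (0,∞)` with `t ↦ t² f(t)`
non-decreasing, the function `F(r) = ∫_0^∞ t^{-a} e^{-b²t} e^{-r²/(c²t)} f(t) dt` satisfies
`c₁ r^{-a+1/2} f(r/(bc)) e^{-2br/c} ≤ F(r) ≤ c₂ r^{-a+1/2} f(r/(bc)) e^{-2br/c}` for `r ≥ 1`. -/
theorem stmt_18 (a b c : ℝ) (ha : 0 ≤ a) (hb : 0 < b) (hc : 0 < c) :
    ∃ c₁ c₂ : ℝ, 0 < c₁ ∧ c₁ ≤ c₂ ∧ ∀ f F : ℝ → ℝ,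
      (∀ t : ℝ, 0 < t → 0 < f t) →
      (∀ s t : ℝ, 0 < s → s ≤ t → f t ≤ f s) →
      (∀ s t : ℝ, 0 < s → s ≤ t → s ^ 2 * f s ≤ t ^ 2 * f t) →
      (∀ r : ℝ, 0 < r → F r = ∫ t in Set.Ioi (0:ℝ),
        t ^ (-a) * Real.exp (-(b ^ 2 * t)) * Real.exp (-(r ^ 2 / (c ^ 2 * t))) * f t) →
      ∀ r : ℝ, 1 ≤ r →
        c₁ * (r ^ (-a + 1 / 2) * f (r / (b * c)) * Real.exp (-(2 * b * r / c))) ≤ F r ∧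
        F r ≤ c₂ * (r ^ (-a + 1 / 2) * f (r / (b * c)) * Real.exp (-(2 * b * r / c))) := by
  obtain ⟨c₁, c₂, h1, h12, H⟩ := aux_key a (b / c) ha (by positivity)
  set K : ℝ := (b * c) ^ (a - 1) / √(b / c) with hK
  have hKp : 0 < K := by positivity
  refine ⟨K * c₁, K * c₂, by positivity, by gcongr, ?_⟩
  intro f F hpos hanti hmono hF r hr
  have hr0 : 0 < r := by linarith
  set T : ℝ := r / (b * c) with hT
  have hT0 : 0 < T := by positivity
  have key := H (fun s => f (T * s)) (b / c * r) (by
      have : 0 < b / c := by positivity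
      nlinarith) (fun t ht => hpos _ (by positivity))
    (fun s t hs hst => hanti _ _ (by positivity) (by gcongr))
    (fun s t hs hst => by
      have := hmono (T * s) (T * t) (by positivity) (by gcongr)
      rw [mul_pow, mul_pow, mul_assoc, mul_assoc] at this
      exact le_of_mul_le_mul_left this (by positivity))
  simp only [mul_one] at key
  set J := ∫ s in Set.Ioi (0:ℝ),
    s ^ (-a) * Real.exp (-(b / c * r * ((s - 1) ^ 2 / s))) * f (T * s) with hJ
  have hFJ : F r = T * T ^ (-a) * Real.exp (-(2 * b * r / c)) * J := by
    rw [hF r hr0]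
    have e := integral_comp_mul_left_Ioi (fun t : ℝ =>
      t ^ (-a) * Real.exp (-(b ^ 2 * t)) * Real.exp (-(r ^ 2 / (c ^ 2 * t))) * f t) 0 hT0
    rw [mul_zero, smul_eq_mul, eq_inv_mul_iff_mul_eq₀ hT0.ne'] at e
    rw [← e, hJ, mul_assoc, mul_assoc, ← mul_assoc (T ^ (-a))]
    congr 1
    rw [← integral_const_mul]
    apply setIntegral_congr_fun measurableSet_Ioi
    intro s hs
    have hs0 : 0 < s := hs
    have ee : Real.exp (-(b ^ 2 * (T * s))) * Real.exp (-(r ^ 2 / (c ^ 2 * (T * s)))) =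
        Real.exp (-(2 * b * r / c)) * Real.exp (-(b / c * r * ((s - 1) ^ 2 / s))) := by
      rw [← Real.exp_add, ← Real.exp_add]
      congr 1
      rw [hT]
      field_simp
      ring
    simp only
    rw [Real.mul_rpow hT0.le hs0.le]
    linear_combination (T ^ (-a) * s ^ (-a) * f (T * s)) * ee
  have hc : K * (r ^ (-a + 1 / 2) * f T * Real.exp (-(2 * b * r / c))) =
      T * T ^ (-a) * Real.exp (-(2 * b * r / c)) * (f T / √(b / c * r)) := by
    have e1 : T * T ^ (-a) = (b * c) ^ (a - 1) * (r * r ^ (-a)) := by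
      rw [hT, Real.div_rpow hr0.le (by positivity), Real.rpow_neg (by positivity : 0 ≤ b * c),
        Real.rpow_sub_one (by positivity)]
      field_simp
    have e2 : r ^ (-a + 1 / 2) * √r = r * r ^ (-a) := by
      rw [Real.sqrt_eq_rpow, ← Real.rpow_add hr0]
      nth_rewrite 2 [← Real.rpow_one r]
      rw [← Real.rpow_add hr0]
      congr 1; ring
    rw [e1, Real.sqrt_mul (by positivity), hK, ← e2]
    field_simp
  have hP : 0 < T * T ^ (-a) * Real.exp (-(2 * b * r / c)) := by positivity
  rw [hFJ]
  constructor
  · calc _ = c₁ * (K * (r ^ (-a + 1 / 2) * f T * Real.exp (-(2 * b * r / c)))) := by ring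
      _ = T * T ^ (-a) * Real.exp (-(2 * b * r / c)) * (c₁ * (f T / √(b / c * r))) := by
        rw [hc]; ring
      _ ≤ _ := by gcongr; exact key.1
  · calc _ ≤ T * T ^ (-a) * Real.exp (-(2 * b * r / c)) * (c₂ * (f T / √(b / c * r))) := by
          gcongr; exact key.2
      _ = c₂ * (K * (r ^ (-a + 1 / 2) * f T * Real.exp (-(2 * b * r / c)))) := by
        rw [hc]; ring
      _ = _ := by ring
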